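/- Equality case of the spherical correlation inequality: let X_k be a Borel subset of the closed hemisphere S^k ∩ {y : ⟨y,o⟩ ≥ 0} (in particular, any centrally symmetric geodesically convex subset of S^k containing o), let X_n = X_k * S^{n-k-1} be its double suspension, and let Y = T_{V₁}(ε) be the tube of width ε ∈ (0, π/2] around S^k = S^n ∩ V₁. Then equality holds in the spherical correlation inequality: μ_n(S^n_+) · μ_n(X_n ∩ Y) = μ_n(X_n) · μ_n(Y ∩ S^n_+), where S^n_+ is the open hemisphere centered at o. -/

import Mathlib

open MeasureTheory Real
open scoped RealInnerProductSpace ENNReal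

/-- Density (up to constant) of the Cauchy measure on `ℝⁿ`. -/
noncomputable def cauchyDensity (n : ℕ) (x : EuclideanSpace ℝ (Fin n)) : ℝ :=
  (1 + ‖x‖ ^ 2) ^ (-(((n : ℝ) + 1) / 2))

/-- Normalizing constant of the Cauchy measure. -/
noncomputable def cauchyConst (n : ℕ) : ℝ :=
  (∫ x : EuclideanSpace ℝ (Fin n), cauchyDensity n x)⁻¹

/-- The Cauchy measure `ν_n` on `ℝⁿ`. -/
noncomputable def cauchyMeasure (n : ℕ) : Measure (EuclideanSpace ℝ (Fin n)) :=
  volume.withDensity fun x => ENNReal.ofReal (cauchyConst n * cauchyDensity n x)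

/-- Gnomonic projection of `ℝⁿ` onto the open upper hemisphere of `Sⁿ ⊆ ℝ^{n+1}`. -/
noncomputable def gnomonic (n : ℕ) (x : EuclideanSpace ℝ (Fin n)) :
    EuclideanSpace ℝ (Fin (n + 1)) :=
  (Real.sqrt (1 + ‖x‖ ^ 2))⁻¹ •
    ((EuclideanSpace.equiv (Fin (n + 1)) ℝ).symm (Fin.snoc (fun i => x i) 1))

/-- The pole `o = e_{n+1}`. -/
noncomputable def pole (n : ℕ) : EuclideanSpace ℝ (Fin (n + 1)) :=
  EuclideanSpace.single (Fin.last n) 1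

/-- The unit sphere `Sⁿ ⊆ ℝ^{n+1}` as a set. -/
noncomputable def unitSphereSet (n : ℕ) : Set (EuclideanSpace ℝ (Fin (n + 1))) :=
  Metric.sphere 0 1

/-- The open hemisphere `Sⁿ₊` centered at the pole. -/
noncomputable def hemisphere (n : ℕ) : Set (EuclideanSpace ℝ (Fin (n + 1))) :=
  {y ∈ unitSphereSet n | 0 < ⟪y, pole n⟫}


/-- The subspace `V₁ = ℝᵏ × {0} × ℝ` of `ℝ^{n+1} = ℝᵏ × ℝ^{n-k} × ℝ`, as a set:
coordinates `i` with `i < k` or `i = n` are free, the rest vanish. -/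
def V1set (n k : ℕ) : Set (EuclideanSpace ℝ (Fin (n + 1))) :=
  {y | ∀ i : Fin (n + 1), ¬((i : ℕ) < k ∨ (i : ℕ) = n) → y i = 0}

/-- The subspace `V₂ = {0} × ℝ^{n-k} × {0}` of `ℝ^{n+1} = ℝᵏ × ℝ^{n-k} × ℝ`, as a set. -/
def V2set (n k : ℕ) : Set (EuclideanSpace ℝ (Fin (n + 1))) :=
  {y | ∀ i : Fin (n + 1), ((i : ℕ) < k ∨ (i : ℕ) = n) → y i = 0}

/-- The totally geodesic subsphere `Sᵏ = Sⁿ ∩ V₁` (contains the pole `o`). -/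
noncomputable def subSphereK (n k : ℕ) : Set (EuclideanSpace ℝ (Fin (n + 1))) :=
  unitSphereSet n ∩ V1set n k

/-- The complementary totally geodesic subsphere `S^{n-k-1} = Sⁿ ∩ V₂`. -/
noncomputable def subSphereCompl (n k : ℕ) : Set (EuclideanSpace ℝ (Fin (n + 1))) :=
  unitSphereSet n ∩ V2set n k

/-- Double suspension (spherical join) `X_k * S^{n-k-1}`. -/
noncomputable def doubleSuspension (n k : ℕ) (Xk : Set (EuclideanSpace ℝ (Fin (n + 1)))) :
    Set (EuclideanSpace ℝ (Fin (n + 1))) :=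
  {y | ∃ a ∈ Xk, ∃ b ∈ subSphereCompl n k, ∃ t ∈ Set.Icc (0 : ℝ) (π / 2),
    y = Real.cos t • a + Real.sin t • b}

/-- Orthogonal projection onto `V₁`. -/
noncomputable def projV1 (n k : ℕ) (y : EuclideanSpace ℝ (Fin (n + 1))) :
    EuclideanSpace ℝ (Fin (n + 1)) :=
  (EuclideanSpace.equiv (Fin (n + 1)) ℝ).symm
    fun i => if ((i : ℕ) < k ∨ (i : ℕ) = n) then y i else 0

/-- The tube of width `ε` around the totally geodesic subsphere `Sᵏ = Sⁿ ∩ V₁`: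
`T_{V₁}(ε) = {y ∈ Sⁿ : ‖P_{V₁} y‖ ≥ cos ε}`. -/
noncomputable def tubeV1 (n k : ℕ) (ε : ℝ) : Set (EuclideanSpace ℝ (Fin (n + 1))) :=
  {y ∈ unitSphereSet n | Real.cos ε ≤ ‖projV1 n k y‖}

lemma exists_eq_smul_of_measure_closedBall_eq {E : Type*} [NormedAddCommGroup E] [NormedSpace ℝ E]
    [FiniteDimensional ℝ E] [MeasurableSpace E] [BorelSpace E] {μ ν : Measure E}
    [IsFiniteMeasure μ] [IsFiniteMeasure ν] (hνμ : ν ≪ μ) {K : Set E} (hK : ∀ᵐ x ∂μ, x ∈ K)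
    (hμ : ∀ x ∈ K, ∀ y ∈ K, ∀ r, μ (Metric.closedBall x r) = μ (Metric.closedBall y r))
    (hν : ∀ x ∈ K, ∀ y ∈ K, ∀ r, ν (Metric.closedBall x r) = ν (Metric.closedBall y r)) :
    ∃ c : ℝ≥0∞, ν = c • μ := by
  by_cases h0 : μ = 0
  · exact ⟨0, by rw [h0] at hνμ; simpa using hνμ⟩
  have := ae_neBot.2 h0
  have h := (Besicovitch.ae_tendsto_rnDeriv ν μ).and hK
  obtain ⟨x, hx, hxK⟩ := h.exists
  refine ⟨ν.rnDeriv μ x, ?_⟩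
  rw [← withDensity_const]
  nth_rw 1 [← Measure.withDensity_rnDeriv_eq ν μ hνμ]
  refine withDensity_congr_ae ?_
  filter_upwards [h] with y ⟨hy, hyK⟩
  refine tendsto_nhds_unique hy (hx.congr fun r => ?_)
  rw [hμ x hxK y hyK, hν x hxK y hyK]

lemma hausdorffMeasure_sphere_inner_nonpos_lt_top {E : Type*} [NormedAddCommGroup E]
    [InnerProductSpace ℝ E] [MeasurableSpace E] [BorelSpace E] {n : ℕ}
    [Fact (Module.finrank ℝ E = n + 1)] {v : E} (hv : ‖v‖ = 1) :
    μH[(n : ℝ)] {x ∈ Metric.sphere (0 : E) 1 | ⟪v, x⟫ ≤ 0} < ∞ := by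
  have : FiniteDimensional ℝ E :=
    Module.finite_of_finrank_eq_succ (Fact.out : Module.finrank ℝ E = n + 1)
  have hfin : Module.finrank ℝ (ℝ ∙ v)ᗮ = n :=
    Submodule.finrank_orthogonal_span_singleton (norm_ne_zero_iff.1 (by simp [hv]))
  let f : (ℝ ∙ v)ᗮ → E := fun w => stereoInvFunAux v w
  have hf : ContDiff ℝ 1 f := contDiff_stereoInvFunAux.comp (ℝ ∙ v)ᗮ.subtypeL.contDiff
  obtain ⟨K, hK⟩ := hf.contDiffOn.exists_lipschitzOnWith one_ne_zero
    (convex_closedBall (0 : (ℝ ∙ v)ᗮ) 2) (isCompact_closedBall _ _)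
  have hsub : {x ∈ Metric.sphere (0 : E) 1 | ⟪v, x⟫ ≤ 0} ⊆ f '' Metric.closedBall 0 2 := by
    rintro x ⟨hx, hxv⟩
    have hne : x ≠ v := by
      rintro rfl
      rw [real_inner_self_eq_norm_sq, hv] at hxv
      norm_num at hxv
    refine ⟨stereoToFun v x, ?_, congrArg Subtype.val (stereo_left_inv hv (x := ⟨x, hx⟩) hne)⟩
    have hx1 : ‖x‖ = 1 := by simpa using hx
    rw [mem_closedBall_zero_iff, stereoToFun_apply, norm_smul]
    have h1 : ‖(ℝ ∙ v)ᗮ.orthogonalProjectionOnto x‖ ≤ 1 :=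
      hx1 ▸ (ℝ ∙ v)ᗮ.norm_orthogonalProjectionOnto_apply_le x
    have h2 : ‖2 / ((1 : ℝ) - innerSL ℝ v x)‖ ≤ 2 := by
      rw [innerSL_apply_apply, Real.norm_of_nonneg (by apply div_nonneg <;> linarith)]
      rw [div_le_iff₀ (by linarith)]
      linarith
    calc _ ≤ (2 : ℝ) * 1 := by gcongr
      _ = 2 := by norm_num
  refine (measure_mono hsub).trans_lt ((hK.hausdorffMeasure_image_le n.cast_nonneg).trans_lt ?_)
  refine ENNReal.mul_lt_top (by simp) ?_
  have := (isCompact_closedBall (0 : (ℝ ∙ v)ᗮ) 2).measure_lt_top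
    (μ := μH[Module.finrank ℝ (ℝ ∙ v)ᗮ])
  rwa [hfin] at this

lemma hausdorffMeasure_sphere_lt_top {E : Type*} [NormedAddCommGroup E]
    [InnerProductSpace ℝ E] [MeasurableSpace E] [BorelSpace E] {n : ℕ}
    [Fact (Module.finrank ℝ E = n + 1)] : μH[(n : ℝ)] (Metric.sphere (0 : E) 1) < ∞ := by
  have : Nontrivial E :=
    Module.nontrivial_of_finrank_eq_succ (Fact.out : Module.finrank ℝ E = n + 1)
  obtain ⟨v, hv⟩ := exists_norm_eq E zero_le_one
  have hsub : Metric.sphere (0 : E) 1 ⊆ {x ∈ Metric.sphere (0 : E) 1 | ⟪v, x⟫ ≤ 0} ∪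
      {x ∈ Metric.sphere (0 : E) 1 | ⟪-v, x⟫ ≤ 0} := fun x hx => by
    rcases le_total ⟪v, x⟫ 0 with h | h
    · exact Or.inl ⟨hx, h⟩
    · exact Or.inr ⟨hx, by simpa [inner_neg_left] using h⟩
  refine (measure_mono hsub).trans_lt
    ((measure_union_le _ _).trans_lt (ENNReal.add_lt_top.2 ⟨?_, ?_⟩))
  · exact hausdorffMeasure_sphere_inner_nonpos_lt_top hv
  · exact hausdorffMeasure_sphere_inner_nonpos_lt_top (by simpa using hv)

section Projection

variable {n k : ℕ}

lemma projV1_apply (y : EuclideanSpace ℝ (Fin (n + 1))) (i : Fin (n + 1)) :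
    projV1 n k y i = if (i : ℕ) < k ∨ (i : ℕ) = n then y i else 0 := rfl

lemma projV1_add (x y : EuclideanSpace ℝ (Fin (n + 1))) :
    projV1 n k (x + y) = projV1 n k x + projV1 n k y := by
  ext i
  simp only [projV1_apply, PiLp.add_apply]
  split_ifs <;> simp

lemma projV1_smul (c : ℝ) (y : EuclideanSpace ℝ (Fin (n + 1))) :
    projV1 n k (c • y) = c • projV1 n k y := by
  ext i
  simp only [projV1_apply, PiLp.smul_apply]
  split_ifs <;> simp

lemma projV1_mem_V1set (y : EuclideanSpace ℝ (Fin (n + 1))) : projV1 n k y ∈ V1set n k :=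
  fun _ hi => if_neg hi

lemma projV1_eq_self {y : EuclideanSpace ℝ (Fin (n + 1))} (hy : y ∈ V1set n k) :
    projV1 n k y = y := by
  ext i
  rw [projV1_apply]
  split_ifs with h
  · rfl
  · exact (hy i h).symm

lemma projV1_eq_zero_iff {y : EuclideanSpace ℝ (Fin (n + 1))} :
    projV1 n k y = 0 ↔ y ∈ V2set n k := by
  refine ⟨fun h i hi => ?_, fun h => ?_⟩
  · have := congrArg (fun z => z i) h
    simpa [projV1_apply, hi] using this
  · ext i
    rw [projV1_apply]
    split_ifs with hi
    · exact h i hi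
    · rfl

lemma sub_projV1_mem_V2set (y : EuclideanSpace ℝ (Fin (n + 1))) :
    y - projV1 n k y ∈ V2set n k := fun i hi => by
  simp [projV1_apply, hi]

lemma inner_eq_zero_of_mem_V1set_of_mem_V2set {a b : EuclideanSpace ℝ (Fin (n + 1))}
    (ha : a ∈ V1set n k) (hb : b ∈ V2set n k) : ⟪a, b⟫ = 0 := by
  rw [PiLp.inner_apply]
  refine Finset.sum_eq_zero fun i _ => ?_
  by_cases hi : (i : ℕ) < k ∨ (i : ℕ) = n
  · simp [hb i hi]
  · simp [ha i hi]

lemma inner_projV1_of_mem_V1set {u : EuclideanSpace ℝ (Fin (n + 1))} (hu : u ∈ V1set n k)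
    (y : EuclideanSpace ℝ (Fin (n + 1))) : ⟪u, projV1 n k y⟫ = ⟪u, y⟫ := by
  have := inner_eq_zero_of_mem_V1set_of_mem_V2set hu (sub_projV1_mem_V2set (k := k) y)
  rw [inner_sub_right] at this
  linarith

lemma norm_sq_projV1_add (y : EuclideanSpace ℝ (Fin (n + 1))) :
    ‖projV1 n k y‖ ^ 2 + ‖y - projV1 n k y‖ ^ 2 = ‖y‖ ^ 2 := by
  have := norm_add_sq_real (projV1 n k y) (y - projV1 n k y)
  rw [add_sub_cancel, inner_eq_zero_of_mem_V1set_of_mem_V2set (projV1_mem_V1set y)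
    (sub_projV1_mem_V2set y)] at this
  linarith

lemma reflection_orthogonal_singleton_apply (u y : EuclideanSpace ℝ (Fin (n + 1))) :
    (ℝ ∙ u)ᗮ.reflection y = y + (-(2 * (⟪u, y⟫ / ‖u‖ ^ 2))) • u := by
  rw [Submodule.reflection_orthogonal_apply, Submodule.reflection_singleton_apply]
  simp only [RCLike.ofReal_real_eq_id, id]
  module

lemma projV1_reflection {u : EuclideanSpace ℝ (Fin (n + 1))} (hu : u ∈ V1set n k)
    (y : EuclideanSpace ℝ (Fin (n + 1))) :
    projV1 n k ((ℝ ∙ u)ᗮ.reflection y) = (ℝ ∙ u)ᗮ.reflection (projV1 n k y) := by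
  rw [reflection_orthogonal_singleton_apply, reflection_orthogonal_singleton_apply, projV1_add,
    projV1_smul, projV1_eq_self hu, inner_projV1_of_mem_V1set hu]

lemma continuous_projV1 : Continuous (projV1 n k) := by
  refine (EuclideanSpace.equiv (Fin (n + 1)) ℝ).symm.continuous.comp (continuous_pi fun i => ?_)
  split_ifs <;> fun_prop

lemma hausdorffMeasure_V2set (hk : 1 ≤ k) (hn : 1 ≤ n) :
    μH[(n : ℝ)] (V2set n k) = 0 := by
  let L : EuclideanSpace ℝ (Fin (n - 1)) → EuclideanSpace ℝ (Fin (n + 1)) := fun z =>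
    (EuclideanSpace.equiv (Fin (n + 1)) ℝ).symm
      fun i => if h : (i : ℕ) - 1 < n - 1 ∧ (i : ℕ) ≠ 0 then z ⟨i - 1, h.1⟩ else 0
  have hL : ContDiff ℝ 1 L := by
    refine (EuclideanSpace.equiv (Fin (n + 1)) ℝ).symm.contDiff.comp (contDiff_pi.2 fun i => ?_)
    split_ifs <;> fun_prop
  have hsub : V2set n k ⊆ Set.range L := fun y hy => by
    refine ⟨(EuclideanSpace.equiv (Fin (n - 1)) ℝ).symm
      fun j => y ⟨j + 1, by omega⟩, ?_⟩
    ext i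
    change (if h : (i : ℕ) - 1 < n - 1 ∧ (i : ℕ) ≠ 0 then
      y ⟨(i : ℕ) - 1 + 1, by omega⟩ else 0) = y i
    split_ifs with h
    · exact congrArg y (Fin.ext (by simp only; omega))
    · exact (hy i (by omega)).symm
  have hdim : dimH (V2set n k) < ((n : NNReal) : ℝ≥0∞) := by
    refine (dimH_mono hsub).trans_lt (hL.dimH_range_le.trans_lt ?_)
    rw [finrank_euclideanSpace_fin]
    exact_mod_cast (by omega : n - 1 < n)
  simpa using hausdorffMeasure_of_dimH_lt hdim

end Projection

section RadialProjection

variable {n k : ℕ}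

/-- Nearest-point retraction of `Sⁿ \ V₂` onto `Sⁿ ∩ V₁`, with value `0` on `V₂`. -/
noncomputable def radialProjV1 (n k : ℕ) (y : EuclideanSpace ℝ (Fin (n + 1))) :
    EuclideanSpace ℝ (Fin (n + 1)) :=
  ‖projV1 n k y‖⁻¹ • projV1 n k y

lemma measurable_radialProjV1 : Measurable (radialProjV1 n k) :=
  have h := (continuous_projV1 (n := n) (k := k)).measurable
  h.norm.inv.smul h

lemma isClosed_subSphereK : IsClosed (subSphereK n k) := by
  refine Metric.isClosed_sphere.inter ?_
  simp only [V1set, Set.ofPred_forall]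
  exact isClosed_iInter fun i => isClosed_iInter fun _ =>
    isClosed_eq (by fun_prop) continuous_const

lemma radialProjV1_mem_subSphereK {y : EuclideanSpace ℝ (Fin (n + 1))} (hy : y ∉ V2set n k) :
    radialProjV1 n k y ∈ subSphereK n k := by
  rw [← projV1_eq_zero_iff] at hy
  refine ⟨?_, fun i hi => ?_⟩
  · simp [unitSphereSet, radialProjV1, norm_smul, hy]
  · simp [radialProjV1, projV1_mem_V1set y i hi]

lemma radialProjV1_reflection {u : EuclideanSpace ℝ (Fin (n + 1))} (hu : u ∈ V1set n k)
    (y : EuclideanSpace ℝ (Fin (n + 1))) :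
    radialProjV1 n k ((ℝ ∙ u)ᗮ.reflection y) = (ℝ ∙ u)ᗮ.reflection (radialProjV1 n k y) := by
  simp only [radialProjV1, projV1_reflection hu, LinearIsometryEquiv.norm_map, map_smul]

lemma radialProjV1_add {a b : EuclideanSpace ℝ (Fin (n + 1))} (ha : a ∈ subSphereK n k)
    (hb : b ∈ V2set n k) {c : ℝ} (hc : 0 < c) (s : ℝ) :
    radialProjV1 n k (c • a + s • b) = a := by
  have ha1 : ‖a‖ = 1 := by simpa [unitSphereSet] using ha.1
  have : projV1 n k (c • a + s • b) = c • a := by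
    rw [projV1_add, projV1_smul, projV1_smul, projV1_eq_self ha.2, projV1_eq_zero_iff.2 hb,
      smul_zero, add_zero]
  rw [radialProjV1, this, norm_smul, ha1, mul_one, Real.norm_of_nonneg hc.le,
    inv_smul_smul₀ hc.ne']

lemma exists_mem_subSphereCompl_sub_projV1_eq (hkn : k < n)
    (y : EuclideanSpace ℝ (Fin (n + 1))) :
    ∃ b ∈ subSphereCompl n k, y - projV1 n k y = ‖y - projV1 n k y‖ • b := by
  by_cases h : y - projV1 n k y = 0
  · refine ⟨EuclideanSpace.single ⟨k, by omega⟩ 1, ⟨by simp [unitSphereSet], fun i hi => ?_⟩,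
      by simp [h]⟩
    rw [PiLp.single_apply, if_neg]
    rintro rfl
    simp only at hi
    omega
  · refine ⟨‖y - projV1 n k y‖⁻¹ • (y - projV1 n k y), ⟨?_, fun i hi => ?_⟩, ?_⟩
    · rw [unitSphereSet, mem_sphere_zero_iff_norm, norm_smul, norm_inv, norm_norm,
        inv_mul_cancel₀ (norm_ne_zero_iff.2 h)]
    · rw [PiLp.smul_apply, sub_projV1_mem_V2set y i hi, smul_zero]
    · rw [smul_inv_smul₀ (norm_ne_zero_iff.2 h)]

lemma mem_doubleSuspension_iff (hkn : k < n) {Xk : Set (EuclideanSpace ℝ (Fin (n + 1)))}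
    (hXk : Xk ⊆ subSphereK n k) {y : EuclideanSpace ℝ (Fin (n + 1))} (hy : y ∉ V2set n k) :
    y ∈ doubleSuspension n k Xk ↔ radialProjV1 n k y ∈ Xk ∧ y ∈ unitSphereSet n := by
  constructor
  · rintro ⟨a, ha, b, hb, t, ht, rfl⟩
    have hc : 0 ≤ cos t := cos_nonneg_of_mem_Icc ⟨by linarith [ht.1, pi_pos], ht.2⟩
    have hc' : cos t ≠ 0 := fun h => hy fun i hi => by
      simp [h, hb.2 i hi]
    refine ⟨by rwa [radialProjV1_add (hXk ha) hb.2 (hc.lt_of_ne' hc')], ?_⟩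
    have ha1 : ‖a‖ = 1 := by simpa [unitSphereSet] using (hXk ha).1
    have hb1 : ‖b‖ = 1 := by simpa [unitSphereSet] using hb.1
    have := norm_add_sq_real (cos t • a) (sin t • b)
    rw [inner_smul_left, inner_smul_right,
      inner_eq_zero_of_mem_V1set_of_mem_V2set (hXk ha).2 hb.2, norm_smul, norm_smul, ha1,
      hb1] at this
    rw [unitSphereSet, mem_sphere_zero_iff_norm]
    exact (sq_eq_sq₀ (norm_nonneg _) zero_le_one).1 (by simpa using this)
  · rintro ⟨hyX, hyS⟩
    have hy0 : ‖projV1 n k y‖ ≠ 0 := norm_ne_zero_iff.2 fun h => hy (projV1_eq_zero_iff.1 h)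
    obtain ⟨b, hb, hyb⟩ := exists_mem_subSphereCompl_sub_projV1_eq hkn y
    have hy1 : ‖y‖ = 1 := by simpa [unitSphereSet] using hyS
    have hsq := norm_sq_projV1_add (k := k) y
    rw [hy1] at hsq
    have hle : ‖projV1 n k y‖ ≤ 1 := by nlinarith [sq_nonneg ‖y - projV1 n k y‖]
    refine ⟨_, hyX, b, hb, arccos ‖projV1 n k y‖,
      ⟨arccos_nonneg _, arccos_le_pi_div_two.2 (norm_nonneg _)⟩, ?_⟩
    have hsin : sin (arccos ‖projV1 n k y‖) = ‖y - projV1 n k y‖ := by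
      rw [sin_arccos, show 1 - ‖projV1 n k y‖ ^ 2 = ‖y - projV1 n k y‖ ^ 2 by linarith,
        sqrt_sq (norm_nonneg _)]
    rw [hsin, ← hyb, cos_arccos (by linarith [norm_nonneg (projV1 n k y)]) hle, radialProjV1,
      smul_inv_smul₀ hy0, add_sub_cancel]

lemma mem_hemisphere_iff {y : EuclideanSpace ℝ (Fin (n + 1))} :
    y ∈ hemisphere n ↔
      radialProjV1 n k y ∈ {z | 0 < ⟪z, pole n⟫} ∧ y ∈ unitSphereSet n := by
  have hp : pole n ∈ V1set n k := fun i hi => by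
    rw [pole, PiLp.single_apply, if_neg]
    rintro rfl
    simp at hi
  have h : ⟪projV1 n k y, pole n⟫ = ⟪y, pole n⟫ := by
    rw [real_inner_comm, inner_projV1_of_mem_V1set hp, real_inner_comm]
  rw [hemisphere, Set.mem_sep_iff, and_comm, Set.mem_ofPred_eq, radialProjV1,
    real_inner_smul_left, h]
  refine and_congr_left fun _ => ?_
  by_cases h0 : projV1 n k y = 0
  · rw [h0, inner_zero_left] at h
    simp [← h]
  · exact (mul_pos_iff_of_pos_left (inv_pos.2 (norm_pos_iff.2 h0))).symm

lemma measure_closedBall_map_radialProjV1 {Z : Set (EuclideanSpace ℝ (Fin (n + 1)))}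
    (hZ : ∀ u ∈ V1set n k, ∀ y, (ℝ ∙ u)ᗮ.reflection y ∈ Z ↔ y ∈ Z) (d : ℝ)
    {x : EuclideanSpace ℝ (Fin (n + 1))} (hx : x ∈ subSphereK n k)
    {y : EuclideanSpace ℝ (Fin (n + 1))} (hy : y ∈ subSphereK n k) (r : ℝ) :
    (μH[d].restrict Z).map (radialProjV1 n k) (Metric.closedBall x r) =
      (μH[d].restrict Z).map (radialProjV1 n k) (Metric.closedBall y r) := by
  have hu : x - y ∈ V1set n k := fun i hi => by simp [hx.2 i hi, hy.2 i hi]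
  have hxy : (ℝ ∙ (x - y))ᗮ.reflection x = y := Submodule.reflection_sub <| by
    rw [mem_sphere_zero_iff_norm.1 hx.1, mem_sphere_zero_iff_norm.1 hy.1]
  have hm (z : EuclideanSpace ℝ (Fin (n + 1))) :
      MeasurableSet (radialProjV1 n k ⁻¹' Metric.closedBall z r) :=
    measurable_radialProjV1 Metric.isClosed_closedBall.measurableSet
  rw [Measure.map_apply measurable_radialProjV1 Metric.isClosed_closedBall.measurableSet,
    Measure.map_apply measurable_radialProjV1 Metric.isClosed_closedBall.measurableSet,
    Measure.restrict_apply (hm x), Measure.restrict_apply (hm y), eq_comm,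
    ← IsometryEquiv.hausdorffMeasure_preimage (ℝ ∙ (x - y))ᗮ.reflection.toIsometryEquiv]
  congr 1
  ext z
  simp only [Set.mem_inter_iff, Set.mem_preimage, LinearIsometryEquiv.coe_toIsometryEquiv, hZ _ hu,
    radialProjV1_reflection hu, Metric.mem_closedBall]
  rw [← LinearIsometryEquiv.dist_map (ℝ ∙ (x - y))ᗮ.reflection _ x, hxy]

end RadialProjection

/-- Equality case of the spherical correlation inequality for a double
suspension and a tube: `μ_n(Sⁿ₊) · μ_n(X_n ∩ Y) = μ_n(X_n) · μ_n(Y ∩ Sⁿ₊)`. -/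
theorem doubleSuspension_tube_correlation_equality (n k : ℕ) (hk : 1 ≤ k) (hkn : k ≤ n - 1)
    (hn : 1 ≤ n)
    (Xk : Set (EuclideanSpace ℝ (Fin (n + 1)))) (hXkm : MeasurableSet Xk)
    (hXk : Xk ⊆ subSphereK n k ∩ {y | 0 ≤ ⟪y, pole n⟫})
    (ε : ℝ) (hε : ε ∈ Set.Ioc 0 (π / 2)) :
    μH[(n : ℝ)] (hemisphere n) * μH[(n : ℝ)] (doubleSuspension n k Xk ∩ tubeV1 n k ε) =
      μH[(n : ℝ)] (doubleSuspension n k Xk) *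
        μH[(n : ℝ)] (tubeV1 n k ε ∩ hemisphere n) := by
  have : Fact (Module.finrank ℝ (EuclideanSpace ℝ (Fin (n + 1))) = n + 1) := ⟨by simp⟩
  have hkn' : k < n := by omega
  have hfin : μH[(n : ℝ)] (unitSphereSet n) < ∞ := hausdorffMeasure_sphere_lt_top
  have hYS : tubeV1 n k ε ⊆ unitSphereSet n := Set.sep_subset _ _
  have := isFiniteMeasure_restrict.2 hfin.ne
  have := isFiniteMeasure_restrict.2 ((measure_mono hYS).trans_lt hfin).ne
  have hV2 : ∀ᵐ y ∂μH[(n : ℝ)], y ∉ V2set n k :=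
    measure_eq_zero_iff_ae_notMem.1 (hausdorffMeasure_V2set hk hn)
  have hS (u) (_ : u ∈ V1set n k) (y) :
      (ℝ ∙ u)ᗮ.reflection y ∈ unitSphereSet n ↔ y ∈ unitSphereSet n := by
    simp [unitSphereSet]
  have hY (u) (hu : u ∈ V1set n k) (y) :
      (ℝ ∙ u)ᗮ.reflection y ∈ tubeV1 n k ε ↔ y ∈ tubeV1 n k ε := by
    simp [tubeV1, hS u hu, projV1_reflection hu]
  have hK : ∀ᵐ x ∂(μH[(n : ℝ)].restrict (unitSphereSet n)).map (radialProjV1 n k),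
      x ∈ subSphereK n k := by
    refine (ae_map_iff measurable_radialProjV1.aemeasurable
      isClosed_subSphereK.measurableSet).2 (ae_restrict_of_ae ?_)
    filter_upwards [hV2] with y hy using radialProjV1_mem_subSphereK hy
  obtain ⟨c, hc⟩ := exists_eq_smul_of_measure_closedBall_eq
    (μ := (μH[(n : ℝ)].restrict (unitSphereSet n)).map (radialProjV1 n k))
    (ν := (μH[(n : ℝ)].restrict (tubeV1 n k ε)).map (radialProjV1 n k))
    ((Measure.restrict_mono hYS le_rfl).absolutelyContinuous.map measurable_radialProjV1)
    hK
    (fun x hx y hy r => measure_closedBall_map_radialProjV1 hS _ hx hy r)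
    (fun x hx y hy r => measure_closedBall_map_radialProjV1 hY _ hx hy r)
  have hmS {A : Set (EuclideanSpace ℝ (Fin (n + 1)))} (hA : MeasurableSet A) :
      μH[(n : ℝ)] (radialProjV1 n k ⁻¹' A ∩ tubeV1 n k ε) =
        c * μH[(n : ℝ)] (radialProjV1 n k ⁻¹' A ∩ unitSphereSet n) := by
    have := congrArg (fun m => m A) hc
    simpa [Measure.map_apply measurable_radialProjV1 hA,
      Measure.restrict_apply (measurable_radialProjV1 hA)] using this
  have hX : doubleSuspension n k Xk =ᵐ[μH[(n : ℝ)]]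
      (radialProjV1 n k ⁻¹' Xk ∩ unitSphereSet n : Set _) := by
    filter_upwards [hV2] with y hy
    exact propext (mem_doubleSuspension_iff hkn' (hXk.trans Set.inter_subset_left) hy)
  have hH : hemisphere n =
      radialProjV1 n k ⁻¹' {z | 0 < ⟪z, pole n⟫} ∩ unitSphereSet n :=
    Set.ext fun y => mem_hemisphere_iff
  have hHm : MeasurableSet {z : EuclideanSpace ℝ (Fin (n + 1)) | 0 < ⟪z, pole n⟫} :=
    (isOpen_lt continuous_const (by fun_prop)).measurableSet
  rw [measure_congr (hX.inter (ae_eq_refl (tubeV1 n k ε))), measure_congr hX, hH,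
    Set.inter_assoc, Set.inter_eq_right.2 hYS, Set.inter_comm (tubeV1 n k ε),
    Set.inter_assoc, Set.inter_eq_right.2 hYS, hmS hXkm, hmS hHm]
  ring
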